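/- Let m ≥ 2. If τ and τ′ are two traceless symmetric trilinear forms on the standard Euclidean space ℝ^m, both satisfying the superconformal identity, then there exists a linear isometry A of ℝ^m such that τ′(x,y,z) = τ(Ax,Ay,Az) for all x, y, z ∈ ℝ^m. In other words, the traceless symmetric trilinear forms on ℝ^m satisfying the superconformal identity form a single orbit under the natural action of the orthogonal group O(m). -/

import Mathlib

open scoped BigOperators RealInnerProductSpace

/-- A trilinear form is symmetric if it is invariant under all permutations of its
arguments (generated by the two adjacent transpositions). -/
def TrilinearIsSymm (m : ℕ)
    (τ : EuclideanSpace ℝ (Fin m) →ₗ[ℝ] EuclideanSpace ℝ (Fin m) →ₗ[ℝ]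
          EuclideanSpace ℝ (Fin m) →ₗ[ℝ] ℝ) : Prop :=
  (∀ x y z, τ x y z = τ y x z) ∧ (∀ x y z, τ x y z = τ x z y)

/-- A trilinear form is traceless if `∑ᵣ τ(eᵣ, eᵣ, y) = 0` for every `y`, where `(eᵣ)` is
the standard orthonormal basis of `ℝ^m`. -/
def TrilinearIsTraceless (m : ℕ)
    (τ : EuclideanSpace ℝ (Fin m) →ₗ[ℝ] EuclideanSpace ℝ (Fin m) →ₗ[ℝ]
          EuclideanSpace ℝ (Fin m) →ₗ[ℝ] ℝ) : Prop :=
  ∀ y : EuclideanSpace ℝ (Fin m),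
    ∑ r : Fin m, τ (EuclideanSpace.single r 1) (EuclideanSpace.single r 1) y = 0

/-- The superconformal identity for a trilinear form on Euclidean `ℝ^m`, expressed using
the standard orthonormal basis `(eᵣ)`:
`∑ᵣ (τ(eᵣ,p,s)τ(eᵣ,q,t) − τ(eᵣ,p,t)τ(eᵣ,q,s)) = −(⟨p,s⟩⟨q,t⟩ − ⟨p,t⟩⟨q,s⟩)`. -/
def TrilinearIsSuperconformal (m : ℕ)
    (τ : EuclideanSpace ℝ (Fin m) →ₗ[ℝ] EuclideanSpace ℝ (Fin m) →ₗ[ℝ]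
          EuclideanSpace ℝ (Fin m) →ₗ[ℝ] ℝ) : Prop :=
  ∀ p q s t : EuclideanSpace ℝ (Fin m),
    ∑ r : Fin m,
      (τ (EuclideanSpace.single r 1) p s * τ (EuclideanSpace.single r 1) q t
        - τ (EuclideanSpace.single r 1) p t * τ (EuclideanSpace.single r 1) q s)
      = -(⟪p, s⟫ * ⟪q, t⟫ - ⟪p, t⟫ * ⟪q, s⟫)

open Module Submodule

section SuperconformalProduct

/-- A commutative product with symmetric traceless multiplication operators whose commutators
are those of a space form: the product attached by the Riesz isomorphism to a traceless symmetric
trilinear form satisfying the superconformal identity with constant `-c`. -/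
structure IsSuperconformalProduct {E : Type*} [NormedAddCommGroup E] [InnerProductSpace ℝ E]
    (c : ℝ) (mul : E →ₗ[ℝ] E →ₗ[ℝ] E) : Prop where
  comm : ∀ x y, mul x y = mul y x
  inner_mul_left : ∀ x y z, ⟪mul x y, z⟫ = ⟪y, mul x z⟫
  trace_eq_zero : ∀ x, LinearMap.trace ℝ E (mul x) = 0
  inner_mul_sub_inner_mul : ∀ p q s t,
    ⟪mul p s, mul q t⟫ - ⟪mul p t, mul q s⟫ = -c * (⟪p, s⟫ * ⟪q, t⟫ - ⟪p, t⟫ * ⟪q, s⟫)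

/-- If a polynomial without constant term satisfies `a t + b t² + d t³ ≤ k t⁴` for all `t`, then
its linear coefficient vanishes and its quadratic coefficient is nonpositive. -/
lemma linear_eq_zero_and_quadratic_nonpos {a b d k : ℝ}
    (h : ∀ t : ℝ, a * t + b * t ^ 2 + d * t ^ 3 ≤ k * t ^ 4) : a = 0 ∧ b ≤ 0 := by
  have nonpos_of_le : ∀ {u : ℝ} {g : ℝ → ℝ}, Continuous g → g 0 = 0 →
      (∀ t > 0, u ≤ g t) → u ≤ 0 := by
    intro u g hg hg0 hu
    have hlim : Filter.Tendsto g (nhdsWithin 0 (Set.Ioi 0)) (nhds 0) := by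
      simpa [hg0] using (hg.tendsto 0).mono_left nhdsWithin_le_nhds
    exact ge_of_tendsto hlim (Filter.eventually_of_mem self_mem_nhdsWithin hu)
  have ha : a = 0 := by
    apply le_antisymm
    · refine nonpos_of_le (g := fun t => k * t ^ 3 - b * t - d * t ^ 2)
        (by fun_prop) (by simp) fun t ht => ?_
      refine le_of_mul_le_mul_right ?_ ht
      linarith [h t]
    · refine neg_nonpos.mp (nonpos_of_le (g := fun t => k * t ^ 3 - b * t + d * t ^ 2)
        (by fun_prop) (by simp) fun t ht => ?_)
      refine le_of_mul_le_mul_right ?_ ht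
      linarith [h (-t)]
  refine ⟨ha, nonpos_of_le (g := fun t => k * t ^ 2 - d * t)
    (by fun_prop) (by simp) fun t ht => ?_⟩
  refine le_of_mul_le_mul_right ?_ (pow_pos ht 2)
  have := h t
  rw [ha] at this
  linarith

variable {E F : Type*} [NormedAddCommGroup E] [InnerProductSpace ℝ E]
  [NormedAddCommGroup F] [InnerProductSpace ℝ F]

lemma coe_orthogonalProjectionOnto_orthogonal_unit [FiniteDimensional ℝ E] {e : E}
    (he : ‖e‖ = 1) (x : E) :
    (((ℝ ∙ e)ᗮ.orthogonalProjectionOnto x : (ℝ ∙ e)ᗮ) : E) = x - ⟪e, x⟫ • e := by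
  rw [coe_orthogonalProjectionOnto_apply, starProjection_orthogonal_val,
    starProjection_unit_singleton ℝ he]

namespace IsSuperconformalProduct

variable {c : ℝ} {mul : E →ₗ[ℝ] E →ₗ[ℝ] E}

lemma inner_mul_swap (h : IsSuperconformalProduct c mul) (x y z : E) :
    ⟪mul x y, z⟫ = ⟪mul x z, y⟫ := by
  rw [h.inner_mul_left, real_inner_comm]

lemma inner_mul_rotate (h : IsSuperconformalProduct c mul) (x y z : E) :
    ⟪mul x y, z⟫ = ⟪mul y z, x⟫ := by
  rw [h.comm, h.inner_mul_swap]

/-- The cubic form of a product attains its maximum over the unit sphere, which bounds it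
everywhere by homogeneity. -/
lemma exists_cubic_le [FiniteDimensional ℝ E] [Nontrivial E] (mul : E →ₗ[ℝ] E →ₗ[ℝ] E) :
    ∃ e : E, ‖e‖ = 1 ∧ ∀ v, ⟪mul v v, v⟫ ≤ ⟪mul e e, e⟫ * ‖v‖ ^ 3 := by
  have hcont : Continuous fun v => ⟪mul v v, v⟫ := by
    have : Continuous fun v => mul v v := by
      have h2 : Continuous fun v => LinearMap.toContinuousLinearMap (mul v) :=
        LinearMap.continuous_of_finiteDimensional
          ((LinearMap.toContinuousLinearMap (𝕜 := ℝ) (E := E) (F' := E)).toLinearMap ∘ₗ mul)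
      exact h2.clm_apply continuous_id
    exact this.inner continuous_id
  obtain ⟨e, he, hmax⟩ := (isCompact_sphere (0 : E) 1).exists_isMaxOn
    (NormedSpace.sphere_nonempty.mpr zero_le_one) hcont.continuousOn
  refine ⟨e, by simpa using he, fun v => ?_⟩
  rcases eq_or_ne v 0 with rfl | hv
  · simp
  have hv' : ‖v‖ ≠ 0 := norm_ne_zero_iff.mpr hv
  have hunit : ‖v‖⁻¹ • v ∈ Metric.sphere (0 : E) 1 := by
    simp [norm_smul, hv']
  have hle : ⟪mul (‖v‖⁻¹ • v) (‖v‖⁻¹ • v), ‖v‖⁻¹ • v⟫ ≤ ⟪mul e e, e⟫ := hmax hunit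
  simp only [map_smul, LinearMap.smul_apply, inner_smul_left, inner_smul_right,
    conj_trivial] at hle
  calc ⟪mul v v, v⟫ = (‖v‖⁻¹ * (‖v‖⁻¹ * (‖v‖⁻¹ * ⟪mul v v, v⟫))) * ‖v‖ ^ 3 := by field_simp
    _ ≤ _ := by
      refine mul_le_mul_of_nonneg_right ?_ (by positivity)
      linarith

/-- First and second order conditions at a maximum of the cubic form. -/
lemma maximum_conditions (h : IsSuperconformalProduct c mul) {e : E} (he : ‖e‖ = 1)
    (hmax : ∀ v, ⟪mul v v, v⟫ ≤ ⟪mul e e, e⟫ * ‖v‖ ^ 3) {x : E} (hx : ⟪e, x⟫ = 0) :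
    ⟪mul e e, x⟫ = 0 ∧ ⟪mul e x, x⟫ ≤ ⟪mul e e, e⟫ / 2 * ‖x‖ ^ 2 := by
  have hpos : 0 ≤ ⟪mul e e, e⟫ := by
    have := hmax (-e)
    simp only [map_neg, LinearMap.neg_apply, inner_neg_right, norm_neg, he, neg_neg] at this
    linarith
  have key : ∀ t : ℝ, (3 * ⟪mul e e, x⟫) * t
      + (3 * ⟪mul e x, x⟫ - 3 / 2 * ⟪mul e e, e⟫ * ‖x‖ ^ 2) * t ^ 2
      + ⟪mul x x, x⟫ * t ^ 3 ≤ (⟪mul e e, e⟫ * (3 / 8) * ‖x‖ ^ 4) * t ^ 4 := by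
    intro t
    have hnorm : ‖e + t • x‖ ^ 2 = 1 + (t * ‖x‖) ^ 2 := by
      rw [norm_add_sq_real, inner_smul_right, hx, he, norm_smul, mul_pow, mul_pow,
        Real.norm_eq_abs, sq_abs]
      ring
    have hcube : ‖e + t • x‖ ^ 3 ≤ 1 + 3 / 2 * (t * ‖x‖) ^ 2 + 3 / 8 * (t * ‖x‖) ^ 4 := by
      refine le_of_sq_le_sq ?_ (by positivity)
      rw [← pow_mul, show 3 * 2 = 2 * 3 from rfl, pow_mul, hnorm]
      have h6 : 0 ≤ (t * ‖x‖) ^ 6 := by positivity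
      have h8 : 0 ≤ (t * ‖x‖) ^ 8 := by positivity
      nlinarith
    have hexpand : ⟪mul (e + t • x) (e + t • x), e + t • x⟫ = ⟪mul e e, e⟫
        + 3 * ⟪mul e e, x⟫ * t + 3 * ⟪mul e x, x⟫ * t ^ 2 + ⟪mul x x, x⟫ * t ^ 3 := by
      simp only [map_add, map_smul, LinearMap.add_apply, LinearMap.smul_apply, inner_add_left,
        inner_add_right, inner_smul_left, inner_smul_right, conj_trivial]
      rw [h.comm x e, h.inner_mul_swap e x e, h.inner_mul_rotate x x e |>.trans
        (h.inner_mul_rotate x e x)]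
      ring
    have := (hmax (e + t • x)).trans (mul_le_mul_of_nonneg_left hcube hpos)
    rw [hexpand] at this
    linarith
  obtain ⟨h1, h2⟩ := linear_eq_zero_and_quadratic_nonpos key
  constructor <;> linarith

lemma mul_self_of_maximum (h : IsSuperconformalProduct c mul) {e : E} (he : ‖e‖ = 1)
    (hmax : ∀ v, ⟪mul v v, v⟫ ≤ ⟪mul e e, e⟫ * ‖v‖ ^ 3) :
    mul e e = ⟪mul e e, e⟫ • e := by
  have hee : ⟪e, e⟫ = 1 := by rw [real_inner_self_eq_norm_sq, he, one_pow]
  have hort : ⟪e, mul e e - ⟪mul e e, e⟫ • e⟫ = 0 := by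
    rw [inner_sub_right, inner_smul_right, hee, real_inner_comm]
    ring
  rw [← sub_eq_zero, ← inner_self_eq_zero (𝕜 := ℝ), inner_sub_left, inner_smul_left, hort,
    (h.maximum_conditions he hmax hort).1]
  simp

/-- On the orthogonal complement of a unit vector `e` with `mul e e = lam • e`, multiplication
by `e` is a root of `X² - lam X - c`. -/
lemma mul_mul_of_mul_self (h : IsSuperconformalProduct c mul) {e : E} (he : ‖e‖ = 1) {lam : ℝ}
    (hlam : mul e e = lam • e) {x : E} (hx : ⟪e, x⟫ = 0) :
    mul e (mul e x) = lam • mul e x + c • x := by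
  have hee : ⟪e, e⟫ = 1 := by rw [real_inner_self_eq_norm_sq, he, one_pow]
  refine ext_inner_right ℝ fun t => ?_
  have key := h.inner_mul_sub_inner_mul x e e t
  rw [hlam, inner_smul_right, h.comm x e, hee, real_inner_comm e x, hx,
    ← h.inner_mul_left e (mul e x) t, h.inner_mul_swap x t e, h.comm x e] at key
  rw [inner_add_left, inner_smul_left, inner_smul_left, conj_trivial, conj_trivial]
  linarith

/-- At a maximum `e` of the cubic form, multiplication by `e` is a negative scalar on the
orthogonal complement of `e`. -/
lemma exists_mul_eq_smul (h : IsSuperconformalProduct c mul) (hc : 0 < c) {e : E} (he : ‖e‖ = 1)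
    (hmax : ∀ v, ⟪mul v v, v⟫ ≤ ⟪mul e e, e⟫ * ‖v‖ ^ 3) :
    ∃ μ < 0, μ ^ 2 - ⟪mul e e, e⟫ * μ = c ∧ ∀ x, ⟪e, x⟫ = 0 → mul e x = μ • x := by
  have hlam := h.mul_self_of_maximum he hmax
  set lam := ⟪mul e e, e⟫ with hlam_def
  set δ := √(lam ^ 2 + 4 * c)
  have hδ : δ ^ 2 = lam ^ 2 + 4 * c := Real.sq_sqrt (by positivity)
  have hδpos : 0 < δ := Real.sqrt_pos.mpr (by positivity)
  have hlamδ : lam < δ := Real.lt_sqrt_of_sq_lt (by linarith)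
  refine ⟨(lam - δ) / 2, by linarith, by linarith, fun x hx => ?_⟩
  set y := mul e x - ((lam - δ) / 2) • x with hy
  have hey : ⟪e, y⟫ = 0 := by
    rw [hy, inner_sub_right, ← h.inner_mul_left, hlam, inner_smul_left, inner_smul_right, hx]
    simp
  have hmul : mul e y = ((lam + δ) / 2) • y := by
    rw [hy, map_sub, map_smul, h.mul_mul_of_mul_self he hlam hx,
      show c = (δ ^ 2 - lam ^ 2) / 4 by linarith]
    module
  have hle := (h.maximum_conditions he hmax hey).2
  rw [hmul, inner_smul_left, conj_trivial, real_inner_self_eq_norm_sq, ← hlam_def] at hle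
  have hy0 : ‖y‖ ^ 2 = 0 := by
    nlinarith [sq_nonneg ‖y‖]
  exact sub_eq_zero.mp (norm_eq_zero.mp (pow_eq_zero_iff two_ne_zero |>.mp hy0))

end IsSuperconformalProduct

/-- The product induced on the orthogonal complement of a vector. -/
noncomputable def orthogonalCompression [FiniteDimensional ℝ E] (mul : E →ₗ[ℝ] E →ₗ[ℝ] E) (e : E) :
    (ℝ ∙ e)ᗮ →ₗ[ℝ] (ℝ ∙ e)ᗮ →ₗ[ℝ] (ℝ ∙ e)ᗮ :=
  (mul.compl₁₂ (ℝ ∙ e)ᗮ.subtype (ℝ ∙ e)ᗮ.subtype).compr₂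
    (ℝ ∙ e)ᗮ.orthogonalProjectionOnto.toLinearMap

lemma orthogonalCompression_apply [FiniteDimensional ℝ E] (mul : E →ₗ[ℝ] E →ₗ[ℝ] E) (e : E)
    (x y : (ℝ ∙ e)ᗮ) :
    orthogonalCompression mul e x y = (ℝ ∙ e)ᗮ.orthogonalProjectionOnto (mul x y) := rfl

/-- `e` is a unit eigenvector of multiplication by `e` with eigenvalue `lam`, and multiplication
by `e` is the scalar `μ` on the orthogonal complement of `e`. -/
structure IsPrincipalVector (mul : E →ₗ[ℝ] E →ₗ[ℝ] E) (lam μ : ℝ) (e : E) : Prop where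
  norm_eq_one : ‖e‖ = 1
  mul_self : mul e e = lam • e
  mul_of_inner_eq_zero : ∀ x, ⟪e, x⟫ = 0 → mul e x = μ • x

namespace IsSuperconformalProduct

variable {c lam μ : ℝ} {mul : E →ₗ[ℝ] E →ₗ[ℝ] E} {e : E}

lemma inner_mul_principal (h : IsSuperconformalProduct c mul) (he : IsPrincipalVector mul lam μ e)
    (x y : (ℝ ∙ e)ᗮ) : ⟪e, mul x y⟫ = μ * ⟪(x : E), (y : E)⟫ := by
  rw [real_inner_comm, h.inner_mul_swap, h.comm,
    he.mul_of_inner_eq_zero x (mem_orthogonal_singleton_iff_inner_right.mp x.2),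
    inner_smul_left, conj_trivial]

variable [FiniteDimensional ℝ E]

lemma coe_orthogonalCompression (h : IsSuperconformalProduct c mul)
    (he : IsPrincipalVector mul lam μ e) (x y : (ℝ ∙ e)ᗮ) :
    (orthogonalCompression mul e x y : E) = mul x y - (μ * ⟪(x : E), (y : E)⟫) • e := by
  rw [orthogonalCompression_apply, coe_orthogonalProjectionOnto_orthogonal_unit he.norm_eq_one,
    h.inner_mul_principal he]

/-- The trace of multiplication by a principal vector. -/
lemma finrank_mul_add (h : IsSuperconformalProduct c mul) (he : IsPrincipalVector mul lam μ e) :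
    μ * finrank ℝ E + (lam - μ) = 0 := by
  have hee : ⟪e, e⟫ = 1 := by rw [real_inner_self_eq_norm_sq, he.norm_eq_one, one_pow]
  have hmul : mul e = μ • LinearMap.id + (lam - μ) • (innerₗ E e).smulRight e := by
    ext x
    have hx : mul e (x - ⟪e, x⟫ • e) = μ • (x - ⟪e, x⟫ • e) :=
      he.mul_of_inner_eq_zero _ (by rw [inner_sub_right, inner_smul_right, hee]; ring)
    rw [map_sub, map_smul, he.mul_self, sub_eq_iff_eq_add] at hx
    simp only [hx, LinearMap.add_apply, LinearMap.smul_apply, LinearMap.id_apply,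
      LinearMap.smulRight_apply, innerₗ_apply_apply]
    module
  have htrace := h.trace_eq_zero e
  rw [hmul, map_add, map_smul, map_smul, LinearMap.trace_id, LinearMap.trace_smulRight,
    innerₗ_apply_apply, hee] at htrace
  simpa using htrace

/-- The orthogonal complement of a principal vector inherits a superconformal product. -/
lemma orthogonalCompression (h : IsSuperconformalProduct c mul)
    (he : IsPrincipalVector mul lam μ e) :
    IsSuperconformalProduct (c + μ ^ 2) (orthogonalCompression mul e) where
  comm x y := by rw [orthogonalCompression_apply, orthogonalCompression_apply, h.comm]
  inner_mul_left x y z := by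
    rw [orthogonalCompression_apply, orthogonalCompression_apply,
      inner_orthogonalProjectionOnto_eq_of_mem_right,
      inner_orthogonalProjectionOnto_eq_of_mem_left, h.inner_mul_left]
  trace_eq_zero x := by
    have hcomp : _root_.orthogonalCompression mul e x =
        (ℝ ∙ e)ᗮ.orthogonalProjectionOnto.toLinearMap ∘ₗ (mul x ∘ₗ (ℝ ∙ e)ᗮ.subtype) := rfl
    have hsub : (mul x ∘ₗ (ℝ ∙ e)ᗮ.subtype) ∘ₗ
        (ℝ ∙ e)ᗮ.orthogonalProjectionOnto.toLinearMap =
        mul x - (innerₗ E e).smulRight (mul x e) := by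
      ext y
      simp [coe_orthogonalProjectionOnto_orthogonal_unit he.norm_eq_one]
    have hx := mem_orthogonal_singleton_iff_inner_right.mp x.2
    rw [hcomp, LinearMap.trace_comp_comm', hsub, map_sub, h.trace_eq_zero,
      LinearMap.trace_smulRight, innerₗ_apply_apply, h.comm, he.mul_of_inner_eq_zero _ hx,
      inner_smul_right, hx]
    simp
  inner_mul_sub_inner_mul p q s t := by
    have hinner : ∀ x y z w : (ℝ ∙ e)ᗮ,
        ⟪_root_.orthogonalCompression mul e x y, _root_.orthogonalCompression mul e z w⟫ =
        ⟪mul x y, mul z w⟫ - μ ^ 2 * (⟪(x : E), (y : E)⟫ * ⟪(z : E), (w : E)⟫) := by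
      intro x y z w
      rw [orthogonalCompression_apply mul e z, inner_orthogonalProjectionOnto_eq_of_mem_left,
        h.coe_orthogonalCompression he, inner_sub_left, inner_smul_left, conj_trivial,
        h.inner_mul_principal he]
      ring
    rw [hinner, hinner, coe_inner, coe_inner, coe_inner, coe_inner]
    linarith [h.inner_mul_sub_inner_mul p q s t]

/-- A superconformal product is determined by its restriction to the complement of a principal
vector. -/
lemma mul_eq_of_principal (h : IsSuperconformalProduct c mul)
    (he : IsPrincipalVector mul lam μ e) (a b : ℝ) (x y : (ℝ ∙ e)ᗮ) :
    mul (a • e + x) (b • e + y) = (lam * (a * b) + μ * ⟪x, y⟫) • e +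
      ((a * μ) • y + (b * μ) • x + _root_.orthogonalCompression mul e x y : (ℝ ∙ e)ᗮ) := by
  have hx := mem_orthogonal_singleton_iff_inner_right.mp x.2
  have hy := mem_orthogonal_singleton_iff_inner_right.mp y.2
  simp only [map_add, map_smul, LinearMap.add_apply, LinearMap.smul_apply, he.mul_self,
    he.mul_of_inner_eq_zero _ hy, h.comm x e, he.mul_of_inner_eq_zero _ hx, coe_add, coe_smul,
    h.coe_orthogonalCompression he, coe_inner]
  module

end IsSuperconformalProduct

variable [FiniteDimensional ℝ E]

lemma exists_eq_smul_add_orthogonal {e : E} (he : ‖e‖ = 1) (x : E) :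
    ∃ (a : ℝ) (x₀ : (ℝ ∙ e)ᗮ), x = a • e + x₀ :=
  ⟨⟪e, x⟫, (ℝ ∙ e)ᗮ.orthogonalProjectionOnto x, by
    rw [coe_orthogonalProjectionOnto_orthogonal_unit he]; module⟩

/-- An isometry between the orthogonal complements of two unit vectors extends to one sending the
first vector to the second. -/
lemma exists_linearIsometryEquiv_extend [FiniteDimensional ℝ F]
    (hEF : finrank ℝ E = finrank ℝ F) {e : E} {f : F} (he : ‖e‖ = 1)
    (hf : ‖f‖ = 1) (A₀ : (ℝ ∙ e)ᗮ ≃ₗᵢ[ℝ] (ℝ ∙ f)ᗮ) :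
    ∃ A : E ≃ₗᵢ[ℝ] F, ∀ (a : ℝ) (x : (ℝ ∙ e)ᗮ), A (a • e + x) = a • f + A₀ x := by
  let T : E →ₗ[ℝ] F := (innerₗ E e).smulRight f + (ℝ ∙ f)ᗮ.subtype ∘ₗ
    A₀.toLinearEquiv.toLinearMap ∘ₗ (ℝ ∙ e)ᗮ.orthogonalProjectionOnto.toLinearMap
  have hee : ⟪e, e⟫ = 1 := by rw [real_inner_self_eq_norm_sq, he, one_pow]
  have hT : ∀ (a : ℝ) (x : (ℝ ∙ e)ᗮ), T (a • e + x) = a • f + A₀ x := by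
    intro a x
    have hx := mem_orthogonal_singleton_iff_inner_right.mp x.2
    have hP : (ℝ ∙ e)ᗮ.orthogonalProjectionOnto (a • e + x) = x := by
      ext
      rw [coe_orthogonalProjectionOnto_orthogonal_unit he, inner_add_right, inner_smul_right,
        hee, hx]
      module
    simp [T, hP, inner_add_right, inner_smul_right, he, hx, -map_add]
  have hnorm : ∀ x, ‖T x‖ = ‖x‖ := by
    intro x
    obtain ⟨a, x, rfl⟩ := exists_eq_smul_add_orthogonal he x
    rw [hT, ← sq_eq_sq₀ (norm_nonneg _) (norm_nonneg _), norm_add_sq_real, norm_add_sq_real,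
      inner_smul_left, inner_smul_left, mem_orthogonal_singleton_iff_inner_right.mp x.2,
      mem_orthogonal_singleton_iff_inner_right.mp (A₀ x).2, norm_smul, norm_smul, he, hf,
      norm_coe, norm_coe, A₀.norm_map]
  exact ⟨LinearIsometry.toLinearIsometryEquiv ⟨T, hnorm⟩ hEF, hT⟩

lemma IsSuperconformalProduct.exists_isPrincipalVector [Nontrivial E] {c : ℝ}
    {mul : E →ₗ[ℝ] E →ₗ[ℝ] E} (h : IsSuperconformalProduct c mul) (hc : 0 < c) :
    ∃ e, IsPrincipalVector mul ((finrank ℝ E - 1) * √(c / finrank ℝ E))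
      (-√(c / finrank ℝ E)) e := by
  obtain ⟨e, he, hmax⟩ := exists_cubic_le mul
  obtain ⟨μ, hμ, hroot, hscalar⟩ := h.exists_mul_eq_smul hc he hmax
  have hp : IsPrincipalVector mul ⟪mul e e, e⟫ μ e := ⟨he, h.mul_self_of_maximum he hmax, hscalar⟩
  have htrace := h.finrank_mul_add hp
  have hn : (0 : ℝ) < finrank ℝ E := by exact_mod_cast finrank_pos
  have hsq : c / finrank ℝ E = (-μ) ^ 2 := by
    rw [div_eq_iff hn.ne', ← hroot, show ⟪mul e e, e⟫ = μ - μ * finrank ℝ E by linarith]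
    ring
  have hsqrt : √(c / finrank ℝ E) = -μ := by rw [hsq, Real.sqrt_sq (by linarith)]
  refine ⟨e, ?_⟩
  rw [hsqrt, neg_neg, show (finrank ℝ E - 1) * -μ = ⟪mul e e, e⟫ by linarith]
  exact hp

end SuperconformalProduct

/-- Superconformal products with the same constant on spaces of the same dimension are
isometrically isomorphic. -/
theorem IsSuperconformalProduct.exists_isometry (n : ℕ) :
    ∀ {c : ℝ} (_ : 0 < c) {E F : Type} [NormedAddCommGroup E] [InnerProductSpace ℝ E]
      [FiniteDimensional ℝ E] [NormedAddCommGroup F] [InnerProductSpace ℝ F]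
      [FiniteDimensional ℝ F] (_ : finrank ℝ E = n) (_ : finrank ℝ F = n)
      {mulE : E →ₗ[ℝ] E →ₗ[ℝ] E} {mulF : F →ₗ[ℝ] F →ₗ[ℝ] F}
      (_ : IsSuperconformalProduct c mulE) (_ : IsSuperconformalProduct c mulF),
      ∃ A : E ≃ₗᵢ[ℝ] F, ∀ x y, A (mulE x y) = mulF (A x) (A y) := by
  induction n with
  | zero =>
    intro c _ E F _ _ _ _ _ _ hE hF mulE mulF _ _
    have : Subsingleton F := finrank_zero_iff.mp hF
    exact ⟨(stdOrthonormalBasis ℝ E).equiv (stdOrthonormalBasis ℝ F)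
      (finCongr (hE.trans hF.symm)), fun _ _ => Subsingleton.elim _ _⟩
  | succ n ih =>
    intro c hc E F _ _ _ _ _ _ hE hF mulE mulF hmulE hmulF
    have : Nontrivial E := nontrivial_of_finrank_eq_succ hE
    have : Nontrivial F := nontrivial_of_finrank_eq_succ hF
    obtain ⟨e, he⟩ := hmulE.exists_isPrincipalVector hc
    obtain ⟨f, hf⟩ := hmulF.exists_isPrincipalVector hc
    rw [hE] at he
    rw [hF] at hf
    have : Fact (finrank ℝ E = n + 1) := ⟨hE⟩
    have : Fact (finrank ℝ F = n + 1) := ⟨hF⟩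
    have he0 : e ≠ 0 := norm_ne_zero_iff.mp (by simp [he.norm_eq_one])
    have hf0 : f ≠ 0 := norm_ne_zero_iff.mp (by simp [hf.norm_eq_one])
    obtain ⟨A₀, hA₀⟩ := ih (by positivity) (finrank_orthogonal_span_singleton he0)
      (finrank_orthogonal_span_singleton hf0) (hmulE.orthogonalCompression he)
      (hmulF.orthogonalCompression hf)
    obtain ⟨A, hA⟩ := exists_linearIsometryEquiv_extend (hE.trans hF.symm) he.norm_eq_one
      hf.norm_eq_one A₀
    refine ⟨A, fun x y => ?_⟩
    obtain ⟨a, x, rfl⟩ := exists_eq_smul_add_orthogonal he.norm_eq_one x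
    obtain ⟨b, y, rfl⟩ := exists_eq_smul_add_orthogonal he.norm_eq_one y
    rw [hmulE.mul_eq_of_principal he, hA, hA, hA, hmulF.mul_eq_of_principal hf, map_add, map_add,
      map_smul, map_smul, hA₀, A₀.inner_map_map]

/-- The product attached to a superconformal traceless symmetric trilinear form. -/
lemma exists_isSuperconformalProduct {m : ℕ}
    {τ : EuclideanSpace ℝ (Fin m) →ₗ[ℝ] EuclideanSpace ℝ (Fin m) →ₗ[ℝ]
      EuclideanSpace ℝ (Fin m) →ₗ[ℝ] ℝ}
    (hs : TrilinearIsSymm m τ) (ht : TrilinearIsTraceless m τ)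
    (hsc : TrilinearIsSuperconformal m τ) :
    ∃ mul : EuclideanSpace ℝ (Fin m) →ₗ[ℝ] EuclideanSpace ℝ (Fin m) →ₗ[ℝ]
        EuclideanSpace ℝ (Fin m),
      IsSuperconformalProduct 1 mul ∧ ∀ x y z, ⟪mul x y, z⟫ = τ x y z := by
  let b := EuclideanSpace.basisFun (Fin m) ℝ
  have hb : ∀ r, b r = EuclideanSpace.single r 1 := fun r => by simp [b]
  let riesz : (EuclideanSpace ℝ (Fin m) →ₗ[ℝ] ℝ) →ₗ[ℝ] EuclideanSpace ℝ (Fin m) :=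
    ∑ r, (LinearMap.applyₗ (b r)).smulRight (b r)
  have hriesz : ∀ φ z, ⟪riesz φ, z⟫ = φ z := by
    intro φ z
    conv_rhs => rw [← b.sum_repr' z]
    simp only [riesz, LinearMap.sum_apply, LinearMap.smulRight_apply, LinearMap.applyₗ_apply_apply,
      sum_inner, inner_smul_left, map_sum, map_smul, conj_trivial, smul_eq_mul, mul_comm]
  have hmul : ∀ x y z, ⟪(τ.compr₂ riesz) x y, z⟫ = τ x y z := fun x y z => hriesz _ _
  refine ⟨τ.compr₂ riesz, ⟨fun x y => ?_, fun x y z => ?_, fun x => ?_, fun p q s t => ?_⟩, hmul⟩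
  · exact ext_inner_right ℝ fun z => by rw [hmul, hmul, hs.1]
  · rw [real_inner_comm _ y, hmul, hmul, hs.2]
  · rw [LinearMap.trace_eq_sum_inner _ b, ← ht x]
    refine Finset.sum_congr rfl fun r _ => ?_
    rw [real_inner_comm, hmul, hb, hs.1, hs.2]
  · have hsum : ∀ x y z w, ⟪(τ.compr₂ riesz) x y, (τ.compr₂ riesz) z w⟫ =
        ∑ r, τ (EuclideanSpace.single r 1) x y * τ (EuclideanSpace.single r 1) z w := by
      intro x y z w
      rw [← b.sum_inner_mul_inner]
      refine Finset.sum_congr rfl fun r _ => ?_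
      rw [real_inner_comm _ (b r), hmul, hmul, hb, hs.2 x, hs.1 x, hs.2 z, hs.1 z]
    rw [hsum, hsum, ← Finset.sum_sub_distrib, hsc]
    ring

/-- any two traceless symmetric trilinear forms on `ℝ^m` satisfying the
superconformal identity lie in a single orbit of the orthogonal group `O(m)`. -/
theorem superconformal_trilinear_forms_single_orbit (m : ℕ) (hm : 2 ≤ m)
    (τ τ' : EuclideanSpace ℝ (Fin m) →ₗ[ℝ] EuclideanSpace ℝ (Fin m) →ₗ[ℝ]
          EuclideanSpace ℝ (Fin m) →ₗ[ℝ] ℝ)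
    (hτs : TrilinearIsSymm m τ) (hτt : TrilinearIsTraceless m τ)
    (hτsc : TrilinearIsSuperconformal m τ)
    (hτ's : TrilinearIsSymm m τ') (hτ't : TrilinearIsTraceless m τ')
    (hτ'sc : TrilinearIsSuperconformal m τ') :
    ∃ A : EuclideanSpace ℝ (Fin m) ≃ₗᵢ[ℝ] EuclideanSpace ℝ (Fin m),
      ∀ x y z, τ' x y z = τ (A x) (A y) (A z) := by
  obtain ⟨mul, hmul, hτ⟩ := exists_isSuperconformalProduct hτs hτt hτsc
  obtain ⟨mul', hmul', hτ'⟩ := exists_isSuperconformalProduct hτ's hτ't hτ'sc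
  obtain ⟨A, hA⟩ := IsSuperconformalProduct.exists_isometry m one_pos
    finrank_euclideanSpace_fin finrank_euclideanSpace_fin hmul' hmul
  exact ⟨A, fun x y z => by rw [← hτ', ← hτ, ← hA, A.inner_map_map]⟩
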